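/- Let S be a DDC: a finite set of points in ℤ² with all pairwise difference vectors distinct, contained in a convex region of area s (e.g., a circle or regular polygon containing s grid points). Then |S| ≤ √s + o(√s); in particular, for any ε > 0 and all sufficiently large s, a DDC contained in a shape with s grid points has at most (1+ε)√s dots. -/

import Mathlib

/-- A finite set of dots in `ℤ²` is a distinct difference configuration (DDC):
all difference vectors between distinct pairs of dots are distinct. -/
def IsDDCFinset (B : Finset (ℤ × ℤ)) : Prop :=
  ∀ p ∈ B, ∀ q ∈ B, ∀ p' ∈ B, ∀ q' ∈ B,
    p ≠ q → p - q = p' - q' → p = p' ∧ q = q'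

open scoped Pointwise

theorem IsDDCFinset.addEnergy_le {B : Finset (ℤ × ℤ)} (hB : IsDDCFinset B)
    (W : Finset (ℤ × ℤ)) :
    Finset.addEnergy B W ≤ B.card * W.card + W.card * W.card := by
  classical
  rw [Finset.addEnergy, ← Finset.card_product, ← Finset.card_product, ← Finset.card_disjSum]
  refine Finset.card_le_card_of_injOn
    (fun x => if x.1.1 = x.1.2 then Sum.inl (x.1.1, x.2.1) else Sum.inr x.2) ?_ ?_
  · rintro ⟨⟨a, b⟩, c, d⟩ hx
    simp only [Finset.coe_filter, Finset.mem_product, Set.mem_ofPred_eq] at hx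
    by_cases h : a = b <;> simp [h, hx]
  · rintro ⟨⟨a, b⟩, c, d⟩ hx ⟨⟨a', b'⟩, c', d'⟩ hx' hf
    simp only [Finset.coe_filter, Finset.mem_product, Set.mem_ofPred_eq] at hx hx'
    obtain ⟨⟨⟨ha, hb⟩, -⟩, he⟩ := hx
    obtain ⟨⟨⟨ha', hb'⟩, -⟩, he'⟩ := hx'
    by_cases h : a = b <;> by_cases h' : a' = b' <;> simp only [h, h', if_true, if_false] at hf
    · simp only [Sum.inl.injEq, Prod.mk.injEq] at hf
      subst h h'
      obtain ⟨rfl, rfl⟩ := hf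
      rw [add_left_cancel he.symm, add_left_cancel he'.symm]
    · simp at hf
    · simp at hf
    · simp only [Sum.inr.injEq, Prod.mk.injEq] at hf
      obtain ⟨rfl, rfl⟩ := hf
      have key : a - b = a' - b' := by
        rw [sub_eq_sub_iff_add_eq_add]
        have h1 : a + c + (b' + d) = b + d + (a' + c) := by rw [he, he']
        have h2 : a + b' + (c + d) = a' + b + (c + d) := by
          calc _ = a + c + (b' + d) := by abel
            _ = _ := h1
            _ = _ := by abel
        exact add_right_cancel h2
      obtain ⟨rfl, rfl⟩ := hB a ha b hb a' ha' b' hb' h key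
      rfl

theorem IsDDCFinset.card_sq_mul_card_le {B : Finset (ℤ × ℤ)} (hB : IsDDCFinset B)
    (W : Finset (ℤ × ℤ)) :
    B.card ^ 2 * W.card ≤ (B + W).card * (B.card + W.card) := by
  rcases Nat.eq_zero_or_pos W.card with hW | hW
  · simp [hW]
  have h1 := Finset.le_card_add_mul_addEnergy B W
  have h2 := Nat.mul_le_mul_left (B + W).card (hB.addEnergy_le W)
  refine Nat.le_of_mul_le_mul_right ?_ hW
  nlinarith

/-- A finite set of grid points which is the set of all grid points of a convex region. -/
def IsLatticeConvex (S : Finset (ℤ × ℤ)) : Prop :=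
  ∃ C : Set (ℝ × ℝ), Convex ℝ C ∧ ∀ p : ℤ × ℤ, p ∈ S ↔ (((p.1 : ℝ), (p.2 : ℝ)) : ℝ × ℝ) ∈ C

theorem Convex.mk_mem {C : Set (ℝ × ℝ)} (hC : Convex ℝ C) {x₁ y₁ x₂ y₂ a b x y : ℝ}
    (h₁ : (x₁, y₁) ∈ C) (h₂ : (x₂, y₂) ∈ C) (ha : 0 ≤ a) (hb : 0 ≤ b) (hab : a + b = 1)
    (hx : x = a * x₁ + b * x₂) (hy : y = a * y₁ + b * y₂) : (x, y) ∈ C := by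
  have := hC h₁ h₂ ha hb hab
  simpa [hx, hy] using this

theorem Convex.mk_mem_of_row {C : Set (ℝ × ℝ)} (hC : Convex ℝ C) {x₁ x₂ x y : ℝ}
    (h₁ : (x₁, y) ∈ C) (h₂ : (x₂, y) ∈ C) (hx₁ : x₁ ≤ x) (hx₂ : x ≤ x₂) : (x, y) ∈ C := by
  rcases hx₁.eq_or_lt with rfl | hlt
  · exact h₁
  have hpos : 0 < x₂ - x₁ := by linarith
  refine hC.mk_mem h₁ h₂ (a := (x₂ - x) / (x₂ - x₁)) (b := (x - x₁) / (x₂ - x₁))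
    (div_nonneg (by linarith) hpos.le) (div_nonneg (by linarith) hpos.le) ?_ ?_ ?_
  · field_simp; ring
  · field_simp; ring
  · field_simp; ring

/-- The number of integers lying outside a convex set but within distance `u` to the right
of it is at most `u`. -/
theorem card_le_of_convex_shift {D : Set ℝ} (hD : Convex ℝ D) (u : ℕ) (F : Finset ℤ)
    (hF : ∀ x ∈ F, (x : ℝ) ∉ D ∧ ∃ t : ℝ, 0 ≤ t ∧ t ≤ u ∧ (x : ℝ) - t ∈ D) :
    F.card ≤ u := by
  rcases F.eq_empty_or_nonempty with rfl | hne
  · simp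
  set m := F.min' hne
  have hm := F.min'_mem hne
  obtain ⟨hmD, t, ht, -, htD⟩ := hF m hm
  have hsub : F ⊆ Finset.Ico m (m + u) := by
    intro x hx
    obtain ⟨-, t', -, htu', htD'⟩ := hF x hx
    have hlt : (x : ℝ) - t' < m := by
      by_contra! hle
      exact hmD (hD.ordConnected.out htD htD' ⟨by linarith, hle⟩)
    have : (x : ℝ) < ((m + u : ℤ) : ℝ) := by push_cast; linarith
    exact Finset.mem_Ico.2 ⟨F.min'_le x hx, by exact_mod_cast this⟩
  simpa using Finset.card_le_card hsub

/-- Adding a box to the grid points of a convex region enlarges it by at most a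
perimeter term. -/
theorem IsLatticeConvex.card_add_box_le {S : Finset (ℤ × ℤ)} (hS : IsLatticeConvex S)
    {X h : ℕ} (hX : ∀ p ∈ S, |p.1| ≤ X) (hh : ∀ p ∈ S, |p.2| ≤ h) (u w : ℕ) :
    (S + Finset.Icc (0 : ℤ) u ×ˢ Finset.Icc (0 : ℤ) w).card ≤
      S.card + u * (2 * h + 1) + w * (2 * X + 1 + u) := by
  classical
  obtain ⟨C, hC, hSC⟩ := hS
  set K : Set (ℝ × ℝ) := C ∩ (Set.Icc (-X : ℝ) X ×ˢ Set.Icc (-h : ℝ) h) with hKdef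
  have hK : Convex ℝ K := hC.inter ((convex_Icc _ _).prod (convex_Icc _ _))
  have hSK : ∀ p : ℤ × ℤ, p ∈ S ↔ (((p.1 : ℝ), (p.2 : ℝ)) : ℝ × ℝ) ∈ K := by
    intro p
    refine ⟨fun hp => ⟨(hSC p).1 hp, ?_⟩, fun hp => (hSC p).2 hp.1⟩
    have h1 := abs_le.1 (hX p hp)
    have h2 := abs_le.1 (hh p hp)
    refine ⟨⟨?_, ?_⟩, ?_, ?_⟩
    all_goals dsimp only
    · exact_mod_cast h1.1
    · exact_mod_cast h1.2
    · exact_mod_cast h2.1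
    · exact_mod_cast h2.2
  set L : Set (ℝ × ℝ) := {z | ∃ t : ℝ, 0 ≤ t ∧ t ≤ u ∧ (z.1 - t, z.2) ∈ K} with hLdef
  have hL : Convex ℝ L := by
    rintro ⟨x₁, y₁⟩ ⟨t₁, h1, h1', hz₁⟩ ⟨x₂, y₂⟩ ⟨t₂, h2, h2', hz₂⟩ a b ha hb hab
    refine ⟨a * t₁ + b * t₂, by positivity, ?_, ?_⟩
    · calc a * t₁ + b * t₂ ≤ a * u + b * u := by gcongr
        _ = u := by rw [← add_mul, hab, one_mul]
    · exact hK.mk_mem hz₁ hz₂ ha hb hab (by simp; ring) (by simp)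
  set T : Finset (ℤ × ℤ) :=
    {p ∈ Finset.Icc (-X : ℤ) (X + u) ×ˢ Finset.Icc (-h : ℤ) h |
      (((p.1 : ℝ), (p.2 : ℝ)) : ℝ × ℝ) ∈ L} with hTdef
  have hLT : ∀ p : ℤ × ℤ, (((p.1 : ℝ), (p.2 : ℝ)) : ℝ × ℝ) ∈ L → p ∈ T := by
    intro p hp
    obtain ⟨t, ht, htu, hz⟩ := id hp
    obtain ⟨-, ⟨h1, h2⟩, h3, h4⟩ := hz
    simp only at h1 h2 h3 h4
    simp only [hTdef, Finset.mem_filter, Finset.mem_product, Finset.mem_Icc]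
    refine ⟨⟨⟨?_, ?_⟩, ?_, ?_⟩, hp⟩
    · have : ((-X : ℤ) : ℝ) ≤ p.1 := by push_cast; linarith
      exact_mod_cast this
    · have : (p.1 : ℝ) ≤ ((X + u : ℤ) : ℝ) := by push_cast; linarith
      exact_mod_cast this
    · exact_mod_cast h3
    · exact_mod_cast h4
  have hT : ∀ p ∈ T, (((p.1 : ℝ), (p.2 : ℝ)) : ℝ × ℝ) ∈ L := fun p hp =>
    (Finset.mem_filter.1 hp).2
  have hTcard : (T \ S).card ≤ u * (2 * h + 1) := by
    refine (Finset.card_le_mul_card_image_of_maps_to (f := Prod.snd)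
      (t := Finset.Icc (-h : ℤ) h) ?_ u ?_).trans (Nat.mul_le_mul_left u ?_)
    · intro p hp
      exact (Finset.mem_product.1 (Finset.mem_filter.1 (Finset.mem_sdiff.1 hp).1).1).2
    · intro y _
      rw [← Finset.card_image_of_injOn (f := Prod.fst)]
      · refine card_le_of_convex_shift (D := {x : ℝ | (x, (y : ℝ)) ∈ K}) ?_ u _ ?_
        · intro x₁ h₁ x₂ h₂ a b ha hb hab
          exact hK.mk_mem h₁ h₂ ha hb hab rfl (by rw [← add_mul, hab, one_mul])
        · intro x hx
          simp only [Finset.mem_image, Finset.mem_filter, Finset.mem_sdiff] at hx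
          obtain ⟨p, ⟨⟨hpT, hpS⟩, rfl⟩, rfl⟩ := hx
          exact ⟨fun hmem => hpS ((hSK p).2 hmem), hT p hpT⟩
      · intro p hp q hq hpq
        simp only [Finset.coe_filter, Set.mem_ofPred_eq] at hp hq
        exact Prod.ext hpq (hp.2.trans hq.2.symm)
    · simp; omega
  set R := S + Finset.Icc (0 : ℤ) u ×ˢ Finset.Icc (0 : ℤ) w with hR
  have hRcard : (R \ T).card ≤ w * (2 * X + 1 + u) := by
    have hRmem : ∀ p ∈ R, ∃ j : ℤ, 0 ≤ j ∧ j ≤ w ∧ (p.1, p.2 - j) ∈ T := by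
      intro p hp
      obtain ⟨q, hq, v, hv, rfl⟩ := Finset.mem_add.1 hp
      simp only [Finset.mem_product, Finset.mem_Icc] at hv
      refine ⟨v.2, hv.2.1, hv.2.2, hLT _ ⟨v.1, ?_, ?_, ?_⟩⟩
      · exact_mod_cast hv.1.1
      · exact_mod_cast hv.1.2
      · have := (hSK q).1 hq
        simpa using this
    refine (Finset.card_le_mul_card_image_of_maps_to (f := Prod.fst)
      (t := Finset.Icc (-X : ℤ) (X + u)) ?_ w ?_).trans (Nat.mul_le_mul_left w ?_)
    · intro p hp
      obtain ⟨j, -, -, hj⟩ := hRmem p (Finset.mem_sdiff.1 hp).1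
      exact (Finset.mem_product.1 (Finset.mem_filter.1 hj).1).1
    · intro x _
      rw [← Finset.card_image_of_injOn (f := Prod.snd)]
      · refine card_le_of_convex_shift (D := {y : ℝ | ((x : ℝ), y) ∈ L}) ?_ w _ ?_
        · intro y₁ h₁ y₂ h₂ a b ha hb hab
          exact hL.mk_mem h₁ h₂ ha hb hab (by rw [← add_mul, hab, one_mul]) rfl
        · intro y hy
          simp only [Finset.mem_image, Finset.mem_filter, Finset.mem_sdiff] at hy
          obtain ⟨p, ⟨⟨hpR, hpT⟩, rfl⟩, rfl⟩ := hy
          refine ⟨fun hmem => hpT (hLT p hmem), ?_⟩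
          obtain ⟨j, hj0, hjw, hj⟩ := hRmem p hpR
          refine ⟨j, by exact_mod_cast hj0, by exact_mod_cast hjw, ?_⟩
          have := hT _ hj
          simpa using this
      · intro p hp q hq hpq
        simp only [Finset.coe_filter, Set.mem_ofPred_eq] at hp hq
        exact Prod.ext (hp.2.trans hq.2.symm) hpq
    · simp; omega
  have hsub : R ⊆ S ∪ (T \ S) ∪ (R \ T) := by
    intro p hp
    simp only [Finset.mem_union, Finset.mem_sdiff]
    tauto
  have h1 := Finset.card_le_card hsub
  have h2 := Finset.card_union_le (S ∪ (T \ S)) (R \ T)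
  have h3 := Finset.card_union_le S (T \ S)
  omega

/-- In a lattice convex set with a row of length `N` and a point at height `h` above it, the
triangle they span contains many grid points. -/
theorem IsLatticeConvex.mul_le_card {S : Finset (ℤ × ℤ)} (hS : IsLatticeConvex S)
    {N h : ℕ} {p : ℤ} (h0 : ((0 : ℤ), (0 : ℤ)) ∈ S) (hN : ((N : ℤ), (0 : ℤ)) ∈ S)
    (hp : (p, (h : ℤ)) ∈ S) : (h / 2 + 1) * (N / 2) ≤ S.card := by
  obtain ⟨C, hC, hSC⟩ := hS
  have h0' := (hSC _).1 h0
  have hN' := (hSC _).1 hN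
  have hp' := (hSC _).1 hp
  simp only [Int.cast_zero, Int.cast_natCast] at h0' hN' hp'
  have key : ∀ y ∈ Finset.range (h / 2 + 1), ∀ i ∈ Finset.range (N / 2),
      ((⌈(y : ℝ) / h * p⌉ + (i : ℤ), (y : ℤ)) : ℤ × ℤ) ∈ S := by
    intro y hy i hi
    rw [Finset.mem_range] at hy hi
    have hyh : 2 * (y : ℝ) ≤ h := by exact_mod_cast (by omega : 2 * y ≤ h)
    have hiN : 2 * ((i : ℝ) + 1) ≤ N := by exact_mod_cast (by omega : 2 * (i + 1) ≤ N)
    have hy0 : (0 : ℝ) ≤ y := y.cast_nonneg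
    have hyd : (y : ℝ) / h * h = y := by
      rcases eq_or_ne (h : ℝ) 0 with hh | hh
      · have : (y : ℝ) = 0 := by linarith
        simp [this]
      · field_simp
    set c : ℝ := (y : ℝ) / h with hc
    have hc0 : 0 ≤ c := by positivity
    have hc1 : c ≤ 1 / 2 := by
      rw [hc]
      rcases eq_or_ne (h : ℝ) 0 with hh | hh
      · rw [hh]; norm_num
      · rw [div_le_iff₀ (lt_of_le_of_ne h.cast_nonneg hh.symm)]; linarith
    have hl : (c * p, (y : ℝ)) ∈ C :=
      hC.mk_mem h0' hp' (a := 1 - c) (b := c) (by linarith) hc0 (by ring) (by ring)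
        (by linarith)
    have hr : (c * p + (1 - c) * N, (y : ℝ)) ∈ C :=
      hC.mk_mem hN' hp' (a := 1 - c) (b := c) (by linarith) hc0 (by ring) (by ring)
        (by linarith)
    rw [hSC]
    push_cast
    refine hC.mk_mem_of_row hl hr ?_ ?_
    · have := Int.le_ceil (c * p)
      have : (0 : ℝ) ≤ i := i.cast_nonneg
      linarith
    · have h1 := Int.ceil_lt_add_one (c * p)
      nlinarith [N.cast_nonneg (α := ℝ)]
  rw [← Finset.card_range (h / 2 + 1), ← Finset.card_range (N / 2), ← Finset.card_product]
  refine Finset.card_le_card_of_injOn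
    (fun z => (⌈(z.1 : ℝ) / h * p⌉ + (z.2 : ℤ), (z.1 : ℤ))) ?_ ?_
  · rintro ⟨y, i⟩ hz
    rw [Finset.mem_coe, Finset.mem_product] at hz
    exact key y hz.1 i hz.2
  · rintro ⟨y, i⟩ - ⟨y', i'⟩ - he
    simp only [Prod.mk.injEq, Nat.cast_inj] at he
    obtain ⟨he, rfl⟩ := he
    simpa using he

/-- A lattice convex set whose rows have length at most `N` and which contains points
`(0, 0)` and `(p, h)` of extremal heights with `0 ≤ p ≤ h` is contained in a vertical strip. -/
theorem IsLatticeConvex.abs_fst_le {S : Finset (ℤ × ℤ)} (hS : IsLatticeConvex S)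
    {N h : ℕ} {p : ℤ} (h0 : ((0 : ℤ), (0 : ℤ)) ∈ S) (hp : (p, (h : ℤ)) ∈ S)
    (hp0 : 0 ≤ p) (hph : p ≤ h) (hh : ∀ q ∈ S, |q.2| ≤ h)
    (hrow : ∀ x x' y : ℤ, (x, y) ∈ S → (x', y) ∈ S → x' - x ≤ N) :
    ∀ q ∈ S, |q.1| ≤ ((2 * (N + 2) + h : ℕ) : ℤ) := by
  obtain ⟨C, hC, hSC⟩ := hS
  have h0' := (hSC _).1 h0
  have hp' := (hSC _).1 hp
  simp only [Int.cast_zero, Int.cast_natCast] at h0' hp'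
  have hlen : ∀ (x₁ x₂ : ℝ) (y : ℤ), (x₁, (y : ℝ)) ∈ C → (x₂, (y : ℝ)) ∈ C →
      x₂ - x₁ < N + 2 := by
    intro x₁ x₂ y h₁ h₂
    by_contra! hcon
    have hc := Int.le_ceil x₁
    have hc' := Int.ceil_lt_add_one x₁
    have hNn : (0 : ℝ) ≤ N := N.cast_nonneg
    have := hrow ⌈x₁⌉ (⌈x₁⌉ + N + 1) y
      ((hSC _).2 (hC.mk_mem_of_row h₁ h₂ hc (by linarith)))
      ((hSC _).2 (hC.mk_mem_of_row h₁ h₂ (by push_cast; linarith) (by push_cast; linarith)))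
    omega
  rintro ⟨x, y⟩ hq
  have hq' := (hSC _).1 hq
  have hyh := abs_le.1 (hh _ hq)
  simp only at hq' hyh ⊢
  have hNn : (0 : ℝ) ≤ N := N.cast_nonneg
  have hhn : (0 : ℝ) ≤ h := h.cast_nonneg
  have hp0' : (0 : ℝ) ≤ p := by exact_mod_cast hp0
  have hph' : (p : ℝ) ≤ h := by exact_mod_cast hph
  have hy1 : -(h : ℝ) ≤ y := by exact_mod_cast hyh.1
  have hy2 : (y : ℝ) ≤ h := by exact_mod_cast hyh.2
  suffices hsuff : |(x : ℝ)| ≤ 2 * (N + 2) + h by exact_mod_cast hsuff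
  rw [abs_le]
  rcases h.eq_zero_or_pos with hz | hpos
  · have hy : y = 0 := by omega
    subst hy
    have h1 := hlen 0 x 0 (by simpa using h0') hq'
    have h2 := hlen x 0 0 hq' (by simpa using h0')
    constructor <;> linarith
  have hpos' : (0 : ℝ) < h := by exact_mod_cast hpos
  rcases le_or_gt 0 y with hy | hy
  · have hy0 : (0 : ℝ) ≤ y := by exact_mod_cast hy
    set c : ℝ := (y : ℝ) / h with hc
    have hch : c * h = y := by rw [hc]; field_simp
    have hc0 : 0 ≤ c := by positivity
    have hc1 : c ≤ 1 := (div_le_one hpos').2 hy2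
    have hR : (c * p, (y : ℝ)) ∈ C :=
      hC.mk_mem h0' hp' (a := 1 - c) (b := c) (by linarith) hc0 (by ring) (by ring)
        (by linarith)
    have h1 := hlen _ _ y hR hq'
    have h2 := hlen _ _ y hq' hR
    have h3 : c * p ≤ h := by nlinarith
    have h4 : 0 ≤ c * p := by positivity
    constructor <;> linarith
  · have hy0 : (y : ℝ) < 0 := by exact_mod_cast hy
    have hD : 0 < (h : ℝ) - y := by linarith
    set z : ℝ := (h * x - y * p) / (h - y) with hz
    have hzD : z * (h - y) = h * x - y * p := by rw [hz]; field_simp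
    have hz0 : (z, ((0 : ℤ) : ℝ)) ∈ C := by
      refine hC.mk_mem hq' hp' (a := h / (h - y)) (b := -y / (h - y)) (by positivity)
        (div_nonneg (by linarith) hD.le) (by field_simp; ring) (by rw [hz]; field_simp; ring)
        (by push_cast; field_simp; ring)
    have h1 := hlen z 0 0 hz0 (by simpa using h0')
    have h2 := hlen 0 z 0 (by simpa using h0') hz0
    constructor
    · refine le_of_mul_le_mul_left ?_ hpos'
      nlinarith [mul_nonneg hp0' (by linarith : (0 : ℝ) ≤ h + y)]
    · refine le_of_mul_le_mul_left ?_ hpos'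
      nlinarith [mul_nonneg hp0' (by linarith : (0 : ℝ) ≤ -y)]

theorem IsLatticeConvex.map_addEquiv {S : Finset (ℤ × ℤ)} (hS : IsLatticeConvex S)
    (f : ℤ × ℤ ≃+ ℤ × ℤ) : IsLatticeConvex (S.map f.toEquiv.toEmbedding) := by
  obtain ⟨C, hC, hSC⟩ := hS
  set v := f.symm (1, 0)
  set w := f.symm (0, 1)
  have hf : ∀ p : ℤ × ℤ, f.symm p = (p.1 * v.1 + p.2 * w.1, p.1 * v.2 + p.2 * w.2) := by
    intro p
    have : p = p.1 • ((1 : ℤ), (0 : ℤ)) + p.2 • ((0 : ℤ), (1 : ℤ)) := by simp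
    conv_lhs => rw [this, map_add, map_zsmul, map_zsmul]
    ext <;> simp [v, w]
  refine ⟨{z | (z.1 * v.1 + z.2 * w.1, z.1 * v.2 + z.2 * w.2) ∈ C}, ?_, ?_⟩
  · intro z₁ h₁ z₂ h₂ a b ha hb hab
    refine hC.mk_mem h₁ h₂ ha hb hab ?_ ?_ <;> (simp; ring)
  · intro p
    have : p ∈ S.map f.toEquiv.toEmbedding ↔ f.symm p ∈ S := by
      rw [Finset.mem_map_equiv]; rfl
    rw [this, hSC, hf]
    simp

theorem IsLatticeConvex.map_addRight {S : Finset (ℤ × ℤ)} (hS : IsLatticeConvex S)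
    (a : ℤ × ℤ) : IsLatticeConvex (S.map (Equiv.addRight a).toEmbedding) := by
  obtain ⟨C, hC, hSC⟩ := hS
  refine ⟨{z | (z.1 - a.1, z.2 - a.2) ∈ C}, ?_, ?_⟩
  · intro z₁ h₁ z₂ h₂ s t hs ht hst
    refine hC.mk_mem h₁ h₂ hs ht hst ?_ ?_
    · simp only [Prod.fst_add, Prod.smul_fst, smul_eq_mul]
      linear_combination (a.1 : ℝ) * hst
    · simp only [Prod.snd_add, Prod.smul_snd, smul_eq_mul]
      linear_combination (a.2 : ℝ) * hst
  · intro p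
    rw [Finset.mem_map_equiv, hSC]
    simp [sub_eq_add_neg]

theorem IsDDCFinset.map {B : Finset (ℤ × ℤ)} (hB : IsDDCFinset B) (f : ℤ × ℤ ≃+ ℤ × ℤ)
    (a : ℤ × ℤ) : IsDDCFinset (B.map (f.toEquiv.trans (Equiv.addRight a)).toEmbedding) := by
  intro p hp q hq p' hp' q' hq' hne he
  simp only [Finset.mem_map, Equiv.coe_toEmbedding, Equiv.trans_apply, Equiv.coe_addRight] at *
  obtain ⟨p, hp, rfl⟩ := hp
  obtain ⟨q, hq, rfl⟩ := hq
  obtain ⟨p', hp', rfl⟩ := hp'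
  obtain ⟨q', hq', rfl⟩ := hq'
  have := hB p hp q hq p' hp' q' hq' (by rintro rfl; exact hne rfl)
    (f.injective (by simpa using he))
  simp [this.1, this.2]

/-- A nonzero integer vector divisible by `m` can be moved onto the first coordinate axis by a
unimodular transformation. -/
theorem exists_addEquiv_apply_eq {d : ℤ × ℤ} (hd : d ≠ 0) {m : ℕ} (h₁ : (m : ℤ) ∣ d.1)
    (h₂ : (m : ℤ) ∣ d.2) :
    ∃ (f : ℤ × ℤ ≃+ ℤ × ℤ) (k : ℕ), m ≤ k ∧ f d = ((k : ℤ), (0 : ℤ)) := by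
  obtain ⟨x, y⟩ := d
  simp only at h₁ h₂
  have hg0 : Int.gcd x y ≠ 0 := fun h => hd (by
    rw [Int.gcd_eq_zero_iff] at h
    simp [h.1, h.2])
  have hg0' : (Int.gcd x y : ℤ) ≠ 0 := by exact_mod_cast hg0
  obtain ⟨a, ha⟩ := Int.gcd_dvd_left x y
  obtain ⟨b, hb⟩ := Int.gcd_dvd_right x y
  have hbez := Int.gcd_eq_gcd_ab x y
  set g : ℕ := Int.gcd x y
  set s := Int.gcdA x y
  set t := Int.gcdB x y
  have hone : a * s + b * t = 1 := by
    apply mul_left_cancel₀ hg0'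
    linear_combination -hbez - s * ha - t * hb
  refine ⟨{ toFun := fun p => (s * p.1 + t * p.2, -b * p.1 + a * p.2)
            invFun := fun p => (a * p.1 - t * p.2, b * p.1 + s * p.2)
            left_inv := fun p => Prod.ext ?_ ?_
            right_inv := fun p => Prod.ext ?_ ?_
            map_add' := fun p q => Prod.ext ?_ ?_ }, g, ?_, Prod.ext ?_ ?_⟩
  · simp only; linear_combination p.1 * hone
  · simp only; linear_combination p.2 * hone
  · simp only; linear_combination p.1 * hone
  · simp only; linear_combination p.2 * hone
  · simp only [Prod.fst_add, Prod.snd_add]; ring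
  · simp only [Prod.fst_add, Prod.snd_add]; ring
  · exact Nat.le_of_dvd (Nat.pos_of_ne_zero hg0)
      (Int.natCast_dvd_natCast.1 (Int.dvd_coe_gcd h₁ h₂))
  · simp only [AddEquiv.coe_mk, Equiv.coe_fn_mk]; linear_combination -hbez
  · simp only [AddEquiv.coe_mk, Equiv.coe_fn_mk]; linear_combination -b * ha + a * hb

theorem exists_ne_dvd_sub_of_sq_lt_card {S : Finset (ℤ × ℤ)} {m : ℕ} (hm : 0 < m)
    (hS : m ^ 2 < S.card) :
    ∃ p ∈ S, ∃ q ∈ S, p ≠ q ∧ (m : ℤ) ∣ q.1 - p.1 ∧ (m : ℤ) ∣ q.2 - p.2 := by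
  have hm' : (0 : ℤ) < m := by exact_mod_cast hm
  obtain ⟨p, hp, q, hq, hne, he⟩ := Finset.exists_ne_map_eq_of_card_lt_of_maps_to
    (s := S) (t := Finset.Ico (0 : ℤ) m ×ˢ Finset.Ico (0 : ℤ) m)
    (f := fun p => (p.1 % m, p.2 % m)) (by simpa [← sq] using hS) (by
      intro p _
      simp [Int.emod_nonneg _ hm'.ne', Int.emod_lt_of_pos _ hm'])
  simp only [Prod.mk.injEq] at he
  exact ⟨p, hp, q, hq, hne, Int.ModEq.dvd he.1, Int.ModEq.dvd he.2⟩

/-- A lattice convex set with a longest row of length `N` fits, after a shear, into a small box. -/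
theorem IsLatticeConvex.exists_shear {T : Finset (ℤ × ℤ)} (hT : IsLatticeConvex T) {N : ℕ}
    {x₀ y₀ : ℤ} (h0 : (x₀, y₀) ∈ T) (hN : (x₀ + N, y₀) ∈ T)
    (hrow : ∀ x x' y : ℤ, (x, y) ∈ T → (x', y) ∈ T → x' - x ≤ N) :
    ∃ (g : ℤ × ℤ ≃+ ℤ × ℤ) (a : ℤ × ℤ) (h : ℕ), (h / 2 + 1) * (N / 2) ≤ T.card ∧
      (∀ p ∈ T, |(g p + a).2| ≤ h) ∧
      ∀ p ∈ T, |(g p + a).1| ≤ ((2 * (N + 2) + h : ℕ) : ℤ) := by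
  obtain ⟨P, hP, hmax⟩ := T.exists_max_image (fun p => (p.2 - y₀).natAbs) ⟨_, h0⟩
  set h := (P.2 - y₀).natAbs with hh
  obtain ⟨σ, hσ, hσP⟩ : ∃ σ : ℤ, σ * σ = 1 ∧ σ * (P.2 - y₀) = h := by
    rcases le_total 0 (P.2 - y₀) with hs | hs
    · exact ⟨1, by norm_num, by omega⟩
    · exact ⟨-1, by norm_num, by omega⟩
  set k := (P.1 - x₀) / h with hk
  let g : ℤ × ℤ ≃+ ℤ × ℤ :=
    { toFun := fun p => (p.1 - k * σ * p.2, σ * p.2)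
      invFun := fun p => (p.1 + k * p.2, σ * p.2)
      left_inv := fun p => Prod.ext (by simp only; ring)
        (by simp only; linear_combination p.2 * hσ)
      right_inv := fun p => Prod.ext (by simp only; linear_combination -k * p.2 * hσ)
        (by simp only; linear_combination p.2 * hσ)
      map_add' := fun p q => Prod.ext (by simp only [Prod.fst_add, Prod.snd_add]; ring)
        (by simp only [Prod.snd_add]; ring) }
  have hg : ∀ p, g p + -g (x₀, y₀) = (p.1 - x₀ - k * σ * (p.2 - y₀), σ * (p.2 - y₀)) := by
    intro p
    refine Prod.ext ?_ ?_ <;> simp only [g, AddEquiv.coe_mk, Equiv.coe_fn_mk, Prod.fst_add,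
      Prod.snd_add, Prod.fst_neg, Prod.snd_neg] <;> ring
  set U := (T.map g.toEquiv.toEmbedding).map (Equiv.addRight (-g (x₀, y₀))).toEmbedding with hU
  have hUconv : IsLatticeConvex U := (hT.map_addEquiv g).map_addRight _
  have hUcard : U.card = T.card := by simp [hU]
  have hmem : ∀ p ∈ T, g p + -g (x₀, y₀) ∈ U := by
    intro p hp
    simp only [hU, Finset.mem_map]
    exact ⟨g p, ⟨p, hp, rfl⟩, rfl⟩
  have hmem' : ∀ z ∈ U, ∃ p ∈ T, g p + -g (x₀, y₀) = z := by
    intro z hz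
    simp only [hU, Finset.mem_map] at hz
    obtain ⟨_, ⟨p, hp, rfl⟩, rfl⟩ := hz
    exact ⟨p, hp, rfl⟩
  have hU0 : ((0 : ℤ), (0 : ℤ)) ∈ U := by
    have := hmem _ h0
    rw [hg] at this
    simpa using this
  have hUN : ((N : ℤ), (0 : ℤ)) ∈ U := by
    have := hmem _ hN
    rw [hg] at this
    simpa using this
  have hUheight : ∀ p ∈ T, |(g p + -g (x₀, y₀)).2| ≤ h := by
    intro p hp
    have h1 := hmax p hp
    rw [hg]
    simp only [abs_mul]
    have : |σ| = 1 := by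
      rcases Int.mul_eq_one_iff_eq_one_or_neg_one.1 hσ with hs | hs <;> simp [hs.1]
    rw [this, one_mul, Int.abs_eq_natAbs]
    exact_mod_cast h1
  obtain ⟨p, hp, hp0, hph⟩ : ∃ p : ℤ, (p, (h : ℤ)) ∈ U ∧ 0 ≤ p ∧ p ≤ h := by
    rcases Nat.eq_zero_or_pos h with hz | hpos
    · exact ⟨0, by rw [hz]; exact hU0, le_rfl, by simp⟩
    · have hpos' : (0 : ℤ) < h := by exact_mod_cast hpos
      have h1 := hmem _ hP
      rw [hg, mul_assoc, hσP, hk] at h1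
      have h2 : P.1 - x₀ - (P.1 - x₀) / h * h = (P.1 - x₀) % h := by
        rw [Int.emod_def]; ring
      rw [h2] at h1
      exact ⟨_, h1, Int.emod_nonneg _ hpos'.ne', (Int.emod_lt_of_pos _ hpos').le⟩
  have hUrow : ∀ x x' y : ℤ, (x, y) ∈ U → (x', y) ∈ U → x' - x ≤ N := by
    intro x x' y hx hx'
    obtain ⟨q, hq, he⟩ := hmem' _ hx
    obtain ⟨q', hq', he'⟩ := hmem' _ hx'
    rw [hg, Prod.mk.injEq] at he he'
    have hy : q'.2 = q.2 := by
      linear_combination σ * he'.2 - σ * he.2 + (q.2 - q'.2) * hσ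
    have h1 := hrow q.1 q'.1 q.2 hq (hy ▸ hq')
    rw [hy] at he'
    linarith [he.1, he'.1]
  refine ⟨g, -g (x₀, y₀), h, hUcard ▸ hUconv.mul_le_card hU0 hUN hp, hUheight, ?_⟩
  intro q hq
  refine hUconv.abs_fst_le hU0 hp hp0 hph ?_ hUrow _ (hmem q hq)
  intro z hz
  obtain ⟨q, hq, rfl⟩ := hmem' z hz
  exact hUheight q hq

/-- A lattice convex set with more than `m ^ 2` points fits, after an affine unimodular
transformation, into a box whose dimensions are controlled by the length `N ≥ m` of a row. -/
theorem IsLatticeConvex.exists_coordinates {S : Finset (ℤ × ℤ)} (hS : IsLatticeConvex S)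
    {m : ℕ} (hm : 0 < m) (hcard : m ^ 2 < S.card) :
    ∃ (f : ℤ × ℤ ≃+ ℤ × ℤ) (a : ℤ × ℤ) (N h : ℕ), m ≤ N ∧ (h / 2 + 1) * (N / 2) ≤ S.card ∧
      (∀ p ∈ S, |(f p + a).2| ≤ h) ∧
      ∀ p ∈ S, |(f p + a).1| ≤ ((2 * (N + 2) + h : ℕ) : ℤ) := by
  obtain ⟨p, hp, q, hq, hne, hd₁, hd₂⟩ := exists_ne_dvd_sub_of_sq_lt_card hm hcard
  obtain ⟨f, k, hmk, hf⟩ := exists_addEquiv_apply_eq (d := q - p) (sub_ne_zero.2 hne.symm)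
    (m := m) hd₁ hd₂
  set T := S.map f.toEquiv.toEmbedding with hTdef
  have hT : IsLatticeConvex T := hS.map_addEquiv f
  have hmem : ∀ r ∈ S, f r ∈ T := fun r hr => Finset.mem_map.2 ⟨r, hr, rfl⟩
  rw [map_sub] at hf
  have hf1 : (f q).1 - (f p).1 = k := congrArg Prod.fst hf
  have hf2 : (f q).2 - (f p).2 = 0 := congrArg Prod.snd hf
  obtain ⟨⟨z, z'⟩, hz, hmax⟩ := ((T ×ˢ T).filter fun r => r.1.2 = r.2.2).exists_max_image
    (fun r => r.2.1 - r.1.1) ⟨(f p, f q), by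
      simp only [Finset.mem_filter, Finset.mem_product]
      exact ⟨⟨hmem p hp, hmem q hq⟩, by linarith⟩⟩
  simp only [Finset.mem_filter, Finset.mem_product] at hz hmax
  have hk := hmax (f p, f q) ⟨⟨hmem p hp, hmem q hq⟩, by simp only; linarith⟩
  simp only at hk
  obtain ⟨N, hN⟩ := Int.eq_ofNat_of_zero_le (a := z'.1 - z.1) (by omega)
  obtain ⟨g, a, h, h1, h2, h3⟩ := hT.exists_shear (N := N) (x₀ := z.1) (y₀ := z.2) hz.1.1
    (by
      have : z' = (z.1 + (N : ℤ), z.2) := Prod.ext (by simp only; omega) hz.2.symm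
      exact this ▸ hz.1.2)
    (by
      intro x x' y hx hx'
      have := hmax ((x, y), (x', y)) ⟨⟨hx, hx'⟩, rfl⟩
      simp only at this
      omega)
  refine ⟨f.trans g, a, N, h, by omega, ?_, fun r hr => h2 _ (hmem r hr),
    fun r hr => h3 _ (hmem r hr)⟩
  simpa [hTdef] using h1

/-- Large lattice convex sets have, after an affine unimodular transformation, a box of size
much larger than the square root of the number of points, such that adding the box enlarges the
set only slightly. -/
theorem IsLatticeConvex.exists_window {δ : ℝ} (hδ : 0 < δ) (hδ1 : δ ≤ 1) :
    ∃ s₀ : ℕ, ∀ S : Finset (ℤ × ℤ), s₀ ≤ S.card → IsLatticeConvex S →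
      ∃ (f : ℤ × ℤ ≃+ ℤ × ℤ) (a : ℤ × ℤ) (W : Finset (ℤ × ℤ)),
        √(S.card : ℝ) / δ ≤ W.card ∧
        ((S.map (f.toEquiv.trans (Equiv.addRight a)).toEmbedding + W).card : ℝ) ≤
          (1 + δ) * S.card := by
  set η : ℝ := δ ^ 2 / 4 with hη
  have hη0 : 0 < η := by positivity
  have hη1 : η ≤ 1 := by rw [hη]; nlinarith
  set κ : ℝ := δ * η / 106 with hκ
  have hκ0 : 0 < κ := by positivity
  have hκ1 : κ ≤ 1 := by rw [hκ]; nlinarith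
  refine ⟨max 5 ⌈(1 / (κ ^ 2 * δ)) ^ 2⌉₊, fun S hcard hS => ?_⟩
  have h5 : 5 ≤ S.card := (le_max_left _ _).trans hcard
  have hbig : (1 / (κ ^ 2 * δ)) ^ 2 ≤ (S.card : ℝ) :=
    Nat.ceil_le.1 ((le_max_right _ _).trans hcard)
  set r : ℝ := √(S.card : ℝ) with hr
  have hrr : r * r = S.card := Real.mul_self_sqrt (Nat.cast_nonneg _)
  have hr1 : 1 ≤ r := by
    rw [hr, Real.one_le_sqrt]; exact_mod_cast (by omega : 1 ≤ S.card)
  have hrbig : 1 / (κ ^ 2 * δ) ≤ r := Real.le_sqrt_of_sq_le hbig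
  set m := Nat.sqrt (S.card - 1) with hm
  have hm2 : 2 ≤ m := by rw [hm, Nat.le_sqrt]; omega
  have hmlt : m ^ 2 < S.card := by
    have := Nat.sqrt_le' (S.card - 1)
    rw [← hm] at this
    omega
  have hmgt : S.card ≤ (m + 1) ^ 2 := by
    have := Nat.lt_succ_sqrt' (S.card - 1)
    simp only [Nat.succ_eq_add_one, ← hm] at this
    omega
  obtain ⟨f, a, N, h, hmN, hcount, hh, hX⟩ := hS.exists_coordinates (by omega) hmlt
  set U := S.map (f.toEquiv.trans (Equiv.addRight a)).toEmbedding with hU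
  have hUeq : U = (S.map f.toEquiv.toEmbedding).map (Equiv.addRight a).toEmbedding := by
    rw [hU, Finset.map_map]; rfl
  have hUconv : IsLatticeConvex U := hUeq ▸ (hS.map_addEquiv f).map_addRight a
  have hUcard : U.card = S.card := by simp [hU]
  have hbox := hUconv.card_add_box_le (X := 2 * (N + 2) + h) (h := h)
    (by
      intro z hz
      obtain ⟨p, hp, rfl⟩ := Finset.mem_map.1 hz
      exact hX p hp)
    (by
      intro z hz
      obtain ⟨p, hp, rfl⟩ := Finset.mem_map.1 hz
      exact hh p hp)
  rw [hUcard] at hbox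
  have hprod : (h + 1) * N ≤ 8 * S.card := by
    have h1 : h + 1 ≤ 2 * (h / 2 + 1) := by omega
    have h2 : N ≤ 4 * (N / 2) := by omega
    calc (h + 1) * N ≤ 2 * (h / 2 + 1) * (4 * (N / 2)) := Nat.mul_le_mul h1 h2
      _ = 8 * ((h / 2 + 1) * (N / 2)) := by ring
      _ ≤ _ := Nat.mul_le_mul_left 8 hcount
  have hprod' : ((h : ℝ) + 1) * N ≤ 8 * (r * r) := by rw [hrr]; exact_mod_cast hprod
  have hh0 : (0 : ℝ) ≤ h := h.cast_nonneg
  have hN0 : (0 : ℝ) ≤ N := N.cast_nonneg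
  have hrN : r ≤ 2 * N := by
    rw [hr, Real.sqrt_le_left (by positivity)]
    have h1 : m + 1 ≤ 2 * N := by omega
    exact_mod_cast hmgt.trans (Nat.pow_le_pow_left h1 2)
  have hh16 : (h : ℝ) + 1 ≤ 16 * r := by
    refine le_of_mul_le_mul_right ?_ (by linarith : 0 < r)
    nlinarith
  by_cases hcase : (h : ℝ) + 1 ≤ η * r
  · set u := ⌈r / δ⌉₊ with hu
    have hu1 : r / δ ≤ u := Nat.le_ceil _
    have hrδ : 1 ≤ r / δ := by rw [le_div_iff₀ hδ]; linarith
    have hu2 : (u : ℝ) ≤ 2 * (r / δ) := by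
      have := Nat.ceil_lt_add_one (by positivity : 0 ≤ r / δ)
      linarith
    refine ⟨f, a, Finset.Icc (0 : ℤ) u ×ˢ Finset.Icc (0 : ℤ) (0 : ℕ), ?_, ?_⟩
    · have : (Finset.Icc (0 : ℤ) u ×ˢ Finset.Icc (0 : ℤ) (0 : ℕ)).card = u + 1 := by simp
      rw [this]; push_cast; linarith
    · have h1 : ((U + Finset.Icc (0 : ℤ) u ×ˢ Finset.Icc (0 : ℤ) (0 : ℕ)).card : ℝ) ≤
          S.card + u * (2 * h + 1) := by
        have := hbox u 0
        rw [zero_mul, add_zero] at this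
        exact_mod_cast this
      refine h1.trans ?_
      have h2 : (u : ℝ) * (2 * h + 1) ≤ 2 * (r / δ) * (2 * (η * r)) := by
        gcongr; linarith
      have h3 : 2 * (r / δ) * (2 * (η * r)) = δ * (r * r) := by
        rw [hη]; field_simp; ring
      rw [h3, hrr] at h2
      linarith
  · push Not at hcase
    have hNη : η * N ≤ 8 * r := by
      refine le_of_mul_le_mul_right ?_ (by linarith : 0 < r)
      nlinarith
    set u := ⌊κ * r⌋₊ with hu
    have hu1 : (u : ℝ) ≤ κ * r := Nat.floor_le (by positivity)
    have hu2 : κ * r < u + 1 := Nat.lt_floor_add_one _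
    refine ⟨f, a, Finset.Icc (0 : ℤ) u ×ˢ Finset.Icc (0 : ℤ) u, ?_, ?_⟩
    · have : (Finset.Icc (0 : ℤ) u ×ˢ Finset.Icc (0 : ℤ) u).card = (u + 1) * (u + 1) := by
        simp
      rw [this]
      push_cast
      have h1 : 1 ≤ r * (κ ^ 2 * δ) := (div_le_iff₀ (by positivity)).1 hrbig
      calc r / δ ≤ (κ * r) * (κ * r) := by
            rw [div_le_iff₀ hδ]; nlinarith
        _ ≤ _ := by gcongr
    · have h1 : ((U + Finset.Icc (0 : ℤ) u ×ˢ Finset.Icc (0 : ℤ) u).card : ℝ) ≤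
          S.card + u * (2 * h + 1) + u * (2 * (2 * (N + 2) + h) + 1 + u) := by
        exact_mod_cast hbox u u
      refine h1.trans ?_
      have hur : (u : ℝ) ≤ r := hu1.trans (by nlinarith)
      have hsum : η * (2 * h + 1 + (2 * (2 * (N + 2) + h) + 1 + u)) ≤ 106 * r := by
        have h2 : η * (2 * h + 1 + (2 * (2 * (N + 2) + h) + 1 + u)) =
            4 * (η * N) + η * (4 * h + 10 + u) := by ring
        have h3 : η * (4 * h + 10 + u) ≤ 1 * (4 * h + 10 + u) := by gcongr
        rw [h2]; linarith
      have h4 : (u : ℝ) * (2 * h + 1 + (2 * (2 * (N + 2) + h) + 1 + u)) ≤ δ * (r * r) := by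
        calc (u : ℝ) * (2 * h + 1 + (2 * (2 * (N + 2) + h) + 1 + u))
            ≤ κ * r * (2 * h + 1 + (2 * (2 * (N + 2) + h) + 1 + u)) := by gcongr
          _ = δ * r / 106 * (η * (2 * h + 1 + (2 * (2 * (N + 2) + h) + 1 + u))) := by
              rw [hκ]; ring
          _ ≤ δ * r / 106 * (106 * r) := by gcongr
          _ = _ := by ring
      rw [hrr] at h4
      linarith

/-- Upper bound on DDCs in convex regions: a DDC contained in a convex region
with `s` grid points has at most `√s + o(√s)` dots.  Precisely: for every
`ε > 0` there is `s₀` such that for all `s ≥ s₀`, every DDC contained in a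
convex region containing exactly `s` grid points has at most `(1+ε)·√s` dots. -/
theorem DDC_upper_bound_convex :
    ∀ ε : ℝ, 0 < ε → ∃ s₀ : ℕ, ∀ s : ℕ, s₀ ≤ s →
      ∀ C : Set (ℝ × ℝ), Convex ℝ C →
        ({ p : ℤ × ℤ | (((p.1 : ℝ), (p.2 : ℝ)) : ℝ × ℝ) ∈ C }).ncard = s →
        ∀ B : Finset (ℤ × ℤ), (∀ p ∈ B, (((p.1 : ℝ), (p.2 : ℝ)) : ℝ × ℝ) ∈ C) →
          IsDDCFinset B → (B.card : ℝ) ≤ (1 + ε) * Real.sqrt s := by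
  intro ε hε
  set δ : ℝ := min ε 1 / 2 with hδdef
  have hδ : 0 < δ := by positivity
  have hδ1 : δ ≤ 1 := by linarith [min_le_right ε 1]
  have hδε : 2 * δ ≤ ε := by linarith [min_le_left ε 1]
  obtain ⟨s₀, hs₀⟩ := IsLatticeConvex.exists_window hδ hδ1
  refine ⟨max s₀ 1, fun s hs C hC hcard B hBC hB => ?_⟩
  have hs1 : 1 ≤ s := (le_max_right _ _).trans hs
  have hfin := Set.finite_of_ncard_pos (by omega : 0 <
    ({ p : ℤ × ℤ | (((p.1 : ℝ), (p.2 : ℝ)) : ℝ × ℝ) ∈ C }).ncard)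
  set S := hfin.toFinset with hSdef
  have hScard : S.card = s := by rw [hSdef, ← Set.ncard_eq_toFinset_card _ hfin, hcard]
  have hS : IsLatticeConvex S := ⟨C, hC, fun p => by simp [hSdef]⟩
  have hBS : B ⊆ S := fun p hp => by simpa [hSdef] using hBC p hp
  obtain ⟨f, a, W, hW, hSW⟩ := hs₀ S (hScard ▸ (le_max_left _ _).trans hs) hS
  rw [hScard] at hW hSW
  have hmain := (hB.map f a).card_sq_mul_card_le W
  rw [Finset.card_map] at hmain
  set e := (f.toEquiv.trans (Equiv.addRight a)).toEmbedding
  have hmono : ((B.map e + W).card : ℝ) ≤ (1 + δ) * s := by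
    refine le_trans ?_ hSW
    exact_mod_cast Finset.card_le_card (Finset.add_subset_add_right (Finset.map_subset_map.2 hBS))
  have hmain' : (B.card : ℝ) ^ 2 * W.card ≤ (B.map e + W).card * (B.card + W.card) := by
    exact_mod_cast hmain
  set r : ℝ := √(s : ℝ) with hr
  have hrr : r * r = s := Real.mul_self_sqrt (Nat.cast_nonneg _)
  have hr1 : 1 ≤ r := by rw [hr, Real.one_le_sqrt]; exact_mod_cast hs1
  set b : ℝ := (B.card : ℝ)
  set w : ℝ := (W.card : ℝ)
  have hb0 : 0 ≤ b := Nat.cast_nonneg _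
  have hrw : r ≤ δ * w := by rwa [div_le_iff₀' hδ] at hW
  have hw0 : 0 < w := by
    by_contra! hcon
    nlinarith
  have h1 : b ^ 2 * w ≤ (1 + δ) * (r * r) * (b + w) := by
    rw [hrr]
    exact hmain'.trans (by gcongr)
  have h2 : b ^ 2 ≤ (1 + δ) * (δ * r * b + r * r) := by
    refine le_of_mul_le_mul_right (h1.trans ?_) hw0
    have h3 : r * (r * b) ≤ δ * w * (r * b) := by gcongr
    nlinarith
  have h4 : (b - δ * r) ^ 2 ≤ ((1 + δ) * r) ^ 2 := by
    have h5 : (1 + δ) * (δ * r * b) ≤ 2 * (δ * r * b) := by gcongr; linarith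
    nlinarith [mul_nonneg hδ.le (mul_self_nonneg r)]
  have h6 := abs_le_of_sq_le_sq' h4 (by positivity)
  calc b ≤ (1 + 2 * δ) * r := by linarith [h6.2]
    _ ≤ (1 + ε) * r := by gcongr
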